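/- Let u be C⁴ in a neighborhood of a point x₀ ∈ ℝⁿ, with eigenvalues λ₁(x) ≤ ⋯ ≤ λₙ(x) of D²u(x), and suppose each λ_i is twice differentiable at x₀ in the Alexandrov sense, with first derivatives (λ_i)_a and second derivatives (λ_i)_{ab} at x₀. Choose coordinates in which D²u(x₀) is diagonal with u_{ii}(x₀) = λ_i(x₀). Fix m ∈ {1, …, n} and let ρ ∈ {m, …, n} be the largest integer with λ_ρ(x₀) = λ_m(x₀). Then at x₀ one has the inequality of symmetric n×n matrices Σ_{α=1}^{m} (λ_α)_{ab} ≤ Σ_{α=1}^{m} u_{ααab} + 2 Σ_{α=1}^{m} Σ_{q>ρ} u_{qαa} u_{qαb} / (λ_α − λ_q), i.e. the difference of the right-hand side and the left-hand side is positive semidefinite as a quadratic form in (a,b). -/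

import Mathlib

open Metric Asymptotics

/-- The `i`-th partial derivative (0-based, junk value `0` if `i ≥ n`). -/
noncomputable def pd {n : ℕ} (f : EuclideanSpace ℝ (Fin n) → ℝ)
    (x : EuclideanSpace ℝ (Fin n)) (i : ℕ) : ℝ :=
  if h : i < n then fderiv ℝ f x (EuclideanSpace.single ⟨i, h⟩ 1) else 0

/-- The Hessian matrix of second partial derivatives. -/
noncomputable def hessM {n : ℕ} (u : EuclideanSpace ℝ (Fin n) → ℝ)
    (x : EuclideanSpace ℝ (Fin n)) : Matrix (Fin n) (Fin n) ℝ :=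
  Matrix.of fun i j => pd (fun y => pd u y (j : ℕ)) x (i : ℕ)

/-- Third partial derivative `u_{ijk}` (0-based indices). -/
noncomputable def pd3 {n : ℕ} (u : EuclideanSpace ℝ (Fin n) → ℝ)
    (x : EuclideanSpace ℝ (Fin n)) (i j k : ℕ) : ℝ :=
  pd (fun y => pd (fun z => pd u z k) y j) x i

/-- Fourth partial derivative `u_{ijkl}` (0-based indices). -/
noncomputable def pd4 {n : ℕ} (u : EuclideanSpace ℝ (Fin n) → ℝ)
    (x : EuclideanSpace ℝ (Fin n)) (i j k l : ℕ) : ℝ :=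
  pd (fun y => pd3 u y j k l) x i

open Filter Topology

section

attribute [local instance] Matrix.linftyOpNormedRing Matrix.linftyOpNormedAlgebra

/-- A real symmetric matrix is orthogonally conjugate to the diagonal matrix of the roots of its
characteristic polynomial, listed in any order. -/
theorem Matrix.IsHermitian.exists_orthogonal_diagonal {ι : Type*} [Fintype ι] [DecidableEq ι]
    {A : Matrix ι ι ℝ} (hA : A.IsHermitian) {l : ι → ℝ}
    (hl : A.charpoly = ∏ i, (Polynomial.X - Polynomial.C (l i))) :
    ∃ P : Matrix ι ι ℝ, P * P.transpose = 1 ∧ P.transpose * P = 1 ∧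
      A = P * Matrix.diagonal l * P.transpose := by
  have hB : (Matrix.diagonal l).IsHermitian := Matrix.isHermitian_diagonal l
  have heig : hA.eigenvalues = hB.eigenvalues := by
    rw [Matrix.IsHermitian.eigenvalues_eq_eigenvalues_iff, hl, Matrix.charpoly_diagonal]
  have key : ∀ {M : Matrix ι ι ℝ} (hM : M.IsHermitian), ∃ U : Matrix ι ι ℝ,
      U * U.transpose = 1 ∧ U.transpose * U = 1 ∧
        M = U * Matrix.diagonal hM.eigenvalues * U.transpose := by
    intro M hM
    refine ⟨hM.eigenvectorUnitary, ?_, ?_, ?_⟩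
    · simpa [Matrix.star_eq_conjTranspose] using
        Unitary.coe_mul_star_self hM.eigenvectorUnitary
    · simpa [Matrix.star_eq_conjTranspose] using
        Unitary.coe_star_mul_self hM.eigenvectorUnitary
    · have := hM.spectral_theorem
      rw [Unitary.conjStarAlgAut_apply, Matrix.star_eq_conjTranspose,
        Matrix.conjTranspose_eq_transpose_of_trivial] at this
      exact this
  obtain ⟨U, hU₁, hU₂, hU⟩ := key hA
  obtain ⟨W, hW₁, hW₂, hW⟩ := key hB
  refine ⟨U * W.transpose, ?_, ?_, ?_⟩
  · rw [Matrix.transpose_mul, Matrix.transpose_transpose, Matrix.mul_assoc,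
      ← Matrix.mul_assoc W.transpose, hW₂, Matrix.one_mul, hU₁]
  · rw [Matrix.transpose_mul, Matrix.transpose_transpose, Matrix.mul_assoc,
      ← Matrix.mul_assoc U.transpose, hU₂, Matrix.one_mul, hW₁]
  · rw [hW, hU, heig, Matrix.transpose_mul, Matrix.transpose_transpose]
    calc _ = U * (W.transpose * W) * Matrix.diagonal hB.eigenvalues * (W.transpose * W)
            * U.transpose := by rw [hW₂, Matrix.mul_one, Matrix.mul_one]
      _ = _ := by simp only [Matrix.mul_assoc]

/-- Ky Fan's inequality: the sum of the `m` smallest eigenvalues of a symmetric matrix is at most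
the sum of the first `m` diagonal entries in any orthonormal basis. -/
theorem Matrix.IsHermitian.sum_le_sum_diag_conj {n : ℕ} {A : Matrix (Fin n) (Fin n) ℝ}
    (hA : A.IsHermitian) {l : Fin n → ℝ} (hmono : Monotone l)
    (hl : A.charpoly = ∏ i, (Polynomial.X - Polynomial.C (l i)))
    {Q : Matrix (Fin n) (Fin n) ℝ} (hQ : Q * Q.transpose = 1)
    (hQ' : Q.transpose * Q = 1) (m : Fin n) :
    ∑ i ∈ Finset.Iic m, l i ≤ ∑ i ∈ Finset.Iic m, (Q.transpose * A * Q) i i := by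
  obtain ⟨P, hP₁, hP₂, hP⟩ := hA.exists_orthogonal_diagonal hl
  set W := P.transpose * Q with hW
  have hW₁ : W * W.transpose = 1 := by
    rw [hW, Matrix.transpose_mul, Matrix.transpose_transpose, Matrix.mul_assoc,
      ← Matrix.mul_assoc Q, hQ, Matrix.one_mul, hP₂]
  have hW₂ : W.transpose * W = 1 := by
    rw [hW, Matrix.transpose_mul, Matrix.transpose_transpose, Matrix.mul_assoc,
      ← Matrix.mul_assoc P, hP₁, Matrix.one_mul, hQ']
  have hconj : Q.transpose * A * Q = W.transpose * Matrix.diagonal l * W := by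
    rw [hP, hW, Matrix.transpose_mul, Matrix.transpose_transpose]
    simp only [Matrix.mul_assoc]
  have hdiag : ∀ i, (Q.transpose * A * Q) i i = ∑ j, l j * W j i ^ 2 := by
    intro i
    rw [hconj, Matrix.mul_apply]
    refine Finset.sum_congr rfl fun j _ => ?_
    rw [Matrix.mul_diagonal, Matrix.transpose_apply]
    ring
  have hrow : ∀ j, ∑ i, W j i ^ 2 = 1 := by
    intro j
    have := congrFun (congrFun hW₁ j) j
    simpa [Matrix.mul_apply, sq] using this
  have hcol : ∀ i, ∑ j, W j i ^ 2 = 1 := by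
    intro i
    have := congrFun (congrFun hW₂ i) i
    simpa [Matrix.mul_apply, sq] using this
  simp only [hdiag]
  rw [Finset.sum_comm]
  simp only [← Finset.mul_sum]
  set w : Fin n → ℝ := fun j => ∑ i ∈ Finset.Iic m, W j i ^ 2 with hw
  have hw0 : ∀ j, 0 ≤ w j := fun j => Finset.sum_nonneg fun i _ => sq_nonneg _
  have hw1 : ∀ j, w j ≤ 1 := fun j => (hrow j) ▸
    Finset.sum_le_sum_of_subset_of_nonneg (Finset.subset_univ _) fun i _ _ => sq_nonneg _
  have hsum : ∑ j, w j = ∑ j, if j ≤ m then 1 else 0 := by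
    rw [hw, Finset.sum_comm]
    simp only [hcol]
    rw [← Finset.sum_filter]
    refine Finset.sum_congr ?_ fun _ _ => rfl
    ext; simp
  have hlhs : ∑ i ∈ Finset.Iic m, l i = ∑ j, l j * if j ≤ m then 1 else 0 := by
    simp only [mul_ite, mul_one, mul_zero]
    rw [← Finset.sum_filter]
    refine Finset.sum_congr ?_ fun _ _ => rfl
    ext; simp
  have hterm : ∀ j, 0 ≤ (l j - l m) * (w j - if j ≤ m then 1 else 0) := by
    intro j
    split_ifs with h
    · exact mul_nonneg_of_nonpos_of_nonpos (sub_nonpos.2 (hmono h)) (sub_nonpos.2 (hw1 j))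
    · simpa using mul_nonneg (sub_nonneg.2 (hmono (le_of_not_ge h))) (hw0 j)
  have htot := Finset.sum_nonneg fun j (_ : j ∈ Finset.univ) => hterm j
  have hexp : ∑ j, (l j - l m) * (w j - if j ≤ m then 1 else 0)
      = ∑ j, l j * w j - (∑ j, l j * if j ≤ m then 1 else 0)
        - l m * (∑ j, w j - ∑ j, if j ≤ m then 1 else 0) := by
    rw [← Finset.sum_sub_distrib, ← Finset.sum_sub_distrib, Finset.mul_sum,
      ← Finset.sum_sub_distrib]
    exact Finset.sum_congr rfl fun j _ => by ring
  rw [hexp, hsum, sub_self, mul_zero, sub_zero] at htot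
  rw [hlhs]
  linarith

/-- Differentiating a matrix curve conjugated by a one-parameter group. -/
theorem hasDerivAt_exp_conj {𝔸 : Type*} [NormedRing 𝔸] [NormedAlgebra ℝ 𝔸] [CompleteSpace 𝔸]
    {A : ℝ → 𝔸} {A' : 𝔸} {t : ℝ} (K : 𝔸) (hA : HasDerivAt A A' t) :
    HasDerivAt (fun s : ℝ => NormedSpace.exp (s • (-K)) * A s * NormedSpace.exp (s • K))
      (NormedSpace.exp (t • (-K)) * (A' + (A t * K - K * A t)) * NormedSpace.exp (t • K)) t := by
  have h := ((hasDerivAt_exp_smul_const (-K) t).mul hA).mul (hasDerivAt_exp_smul_const' K t)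
  refine h.congr_deriv ?_
  simp only [Pi.mul_apply]
  noncomm_ring

/-- The symmetric second difference quotient converges to the second derivative. -/
theorem tendsto_symm_second_difference {F F' : ℝ → ℝ} {c : ℝ}
    (hF : ∀ᶠ t in 𝓝 0, HasDerivAt F (F' t) t) (hF' : HasDerivAt F' c 0) :
    Tendsto (fun t => (F t + F (-t) - 2 * F 0) / t ^ 2) (𝓝[>] 0) (𝓝 c) := by
  have hneg : Tendsto (fun t : ℝ => -t) (𝓝 0) (𝓝 0) := by
    simpa using (continuous_neg (G := ℝ)).tendsto 0
  have hF0 : ContinuousAt F 0 := hF.self_of_nhds.continuousAt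
  refine HasDerivAt.lhopital_zero_nhdsGT (f' := fun t => F' t - F' (-t)) (g' := fun t => 2 * t)
    ?_ ?_ ?_ ?_ ?_ ?_
  · refine Filter.Eventually.filter_mono nhdsWithin_le_nhds ?_
    filter_upwards [hF, hneg.eventually hF] with t h₁ h₂
    have h₃ : HasDerivAt (fun s => F (-s)) (F' (-t) * -1) t := h₂.comp t (hasDerivAt_neg t)
    exact ((h₁.add h₃).sub_const _).congr_deriv (by ring)
  · refine Eventually.of_forall fun t => ?_
    simpa using hasDerivAt_pow 2 t
  · filter_upwards [self_mem_nhdsWithin] with t ht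
    exact mul_ne_zero two_ne_zero (ne_of_gt ht)
  · have : Tendsto (fun t => F t + F (-t) - 2 * F 0) (𝓝 0) (𝓝 (F 0 + F 0 - 2 * F 0)) :=
      (hF0.tendsto.add (hF0.tendsto.comp hneg)).sub_const _
    rw [show F 0 + F 0 - 2 * F 0 = 0 by ring] at this
    exact this.mono_left nhdsWithin_le_nhds
  · have : Tendsto (fun t : ℝ => t ^ 2) (𝓝 0) (𝓝 (0 ^ 2)) := (continuous_pow 2).tendsto 0
    rw [zero_pow two_ne_zero] at this
    exact this.mono_left nhdsWithin_le_nhds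
  · have h₂ : HasDerivAt F' c (-0) := by simpa using hF'
    have h₃ : HasDerivAt (fun s => F' s - F' (-s)) (c - c * -1) 0 :=
      hF'.sub (h₂.comp (0 : ℝ) (hasDerivAt_neg 0))
    have h₄ := (h₃.tendsto_slope_zero_right).div_const 2
    rw [show (c - c * -1) / 2 = c by ring] at h₄
    refine h₄.congr fun t => ?_
    simp only [zero_add, neg_zero, sub_self, sub_zero, smul_eq_mul]
    rw [div_eq_mul_inv, div_eq_mul_inv, mul_inv]
    ring

/-- The symmetric second difference quotient of a function with a second-order Taylor
expansion. -/
theorem tendsto_symm_second_difference_of_isLittleO {S : ℝ → ℝ} {b c : ℝ}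
    (hS : (fun t => S t - S 0 - t * b - t ^ 2 / 2 * c) =o[𝓝 0] fun t => t ^ 2) :
    Tendsto (fun t => (S t + S (-t) - 2 * S 0) / t ^ 2) (𝓝[>] 0) (𝓝 c) := by
  have hneg : Tendsto (fun t : ℝ => -t) (𝓝 0) (𝓝 0) := by
    simpa using (continuous_neg (G := ℝ)).tendsto 0
  have h₁ := hS.comp_tendsto hneg
  simp only [Function.comp_def, neg_sq] at h₁
  have h₂ := ((hS.add h₁).tendsto_div_nhds_zero.mono_left
    (nhdsWithin_le_nhds (s := Set.Ioi 0))).add_const c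
  rw [zero_add] at h₂
  refine h₂.congr' ?_
  filter_upwards [self_mem_nhdsWithin] with t ht
  have : t ≠ 0 := ne_of_gt ht
  field_simp
  ring

theorem Matrix.hasDerivAt_of_entries {ι : Type*} [Fintype ι] [DecidableEq ι]
    {A : ℝ → Matrix ι ι ℝ} {A' : Matrix ι ι ℝ} {t : ℝ}
    (h : ∀ i j, HasDerivAt (fun s => A s i j) (A' i j) t) : HasDerivAt A A' t :=
  hasDerivAt_pi.2 fun i => hasDerivAt_pi.2 fun j => h i j

theorem Matrix.hasDerivAt_entry {ι : Type*} [Fintype ι] [DecidableEq ι]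
    {A : ℝ → Matrix ι ι ℝ} {A' : Matrix ι ι ℝ} {t : ℝ}
    (h : HasDerivAt A A' t) (i j : ι) : HasDerivAt (fun s => A s i j) (A' i j) t :=
  hasDerivAt_pi.1 (hasDerivAt_pi.1 h i) j

theorem Matrix.exp_smul_orthogonal {ι : Type*} [Fintype ι] [DecidableEq ι]
    {K : Matrix ι ι ℝ} (hK : K.transpose = -K) (t : ℝ) :
    (NormedSpace.exp (t • K)).transpose = NormedSpace.exp (t • -K) ∧
      NormedSpace.exp (t • K) * NormedSpace.exp (t • -K) = 1 ∧
        NormedSpace.exp (t • -K) * NormedSpace.exp (t • K) = 1 := by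
  have hc : Commute (t • K) (t • -K) := by
    rw [smul_neg]
    exact (Commute.refl _).neg_right
  refine ⟨?_, ?_, ?_⟩
  · rw [← Matrix.exp_transpose, Matrix.transpose_smul, hK]
  · rw [← Matrix.exp_add_of_commute _ _ hc]
    simp
  · rw [← Matrix.exp_add_of_commute _ _ hc.symm]
    simp

/-- The second-order term of a conjugated symmetric matrix curve starting at a diagonal matrix. -/
theorem Matrix.second_variation_diag_apply {n : ℕ} (l : Fin n → ℝ)
    (A B K : Matrix (Fin n) (Fin n) ℝ) (hA : A.transpose = A) (hK : K.transpose = -K)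
    (i : Fin n) :
    (B + (A * K - K * A) + ((A + (Matrix.diagonal l * K - K * Matrix.diagonal l)) * K
      - K * (A + (Matrix.diagonal l * K - K * Matrix.diagonal l)))) i i
      = B i i + ∑ q, (4 * A q i * K q i - 2 * (l i - l q) * K q i ^ 2) := by
  have hA' : ∀ p q, A p q = A q p := fun p q => congrFun (congrFun hA q) p
  have hK' : ∀ p q, K p q = -K q p := fun p q => congrFun (congrFun hK q) p
  simp only [Matrix.add_apply, Matrix.sub_apply, Matrix.mul_apply (M := A),
    Matrix.mul_apply (M := K) (N := A),
    Matrix.mul_apply (M := A + (Matrix.diagonal l * K - K * Matrix.diagonal l)),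
    Matrix.mul_apply (M := K) (N := A + (Matrix.diagonal l * K - K * Matrix.diagonal l)),
    Matrix.diagonal_mul, Matrix.mul_diagonal]
  rw [add_assoc, ← Finset.sum_sub_distrib, ← Finset.sum_sub_distrib, ← Finset.sum_add_distrib]
  congr 1
  refine Finset.sum_congr rfl fun q _ => ?_
  rw [hA' i q, hK' i q]
  ring

/-- The sum of the `m` smallest eigenvalues is bounded to second order along a curve of symmetric
matrices starting at a diagonal matrix, the off-diagonal first-order terms being absorbed by a
rotation of the coordinate frame. -/
theorem Matrix.second_variation_sum_eigenvalues_le {n : ℕ} {H H₁ : ℝ → Matrix (Fin n) (Fin n) ℝ}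
    {H₂ : Matrix (Fin n) (Fin n) ℝ} {l : ℝ → Fin n → ℝ}
    (hsymm : ∀ᶠ t in 𝓝 0, (H t).IsHermitian) (hmono : ∀ᶠ t in 𝓝 0, Monotone (l t))
    (hl : ∀ᶠ t in 𝓝 0,
      (H t).charpoly = ∏ i, (Polynomial.X - Polynomial.C (l t i)))
    (hH : ∀ᶠ t in 𝓝 0, ∀ i j, HasDerivAt (fun s => H s i j) (H₁ t i j) t)
    (hH₁ : ∀ i j, HasDerivAt (fun s => H₁ s i j) (H₂ i j) 0)
    (hdiag : H 0 = Matrix.diagonal (l 0)) (m : Fin n) (R : Fin n → Prop) [DecidablePred R]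
    (hR : ∀ q, R q ↔ l 0 m < l 0 q) {c : ℝ}
    (hc : Tendsto (fun t => (∑ i ∈ Finset.Iic m, l t i + ∑ i ∈ Finset.Iic m, l (-t) i
      - 2 * ∑ i ∈ Finset.Iic m, l 0 i) / t ^ 2) (𝓝[>] 0) (𝓝 c)) :
    c ≤ ∑ i ∈ Finset.Iic m,
      (H₂ i i + 2 * ∑ q, if R q then H₁ 0 q i ^ 2 / (l 0 i - l 0 q) else 0) := by
  have hH₁symm : (H₁ 0).transpose = H₁ 0 := by
    ext i j
    refine (hH.self_of_nhds j i).unique ((hH.self_of_nhds i j).congr_of_eventuallyEq ?_)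
    filter_upwards [hsymm] with t ht
    simpa using ht.apply i j
  have hmono0 : Monotone (l 0) := hmono.self_of_nhds
  have hRi : ∀ i ≤ m, ∀ q, R q → l 0 i < l 0 q := fun i hi q hq =>
    (hmono0 hi).trans_lt ((hR q).1 hq)
  have hnR : ∀ i ≤ m, ¬ R i := fun i hi h => (hRi i hi i h).false
  set K : Matrix (Fin n) (Fin n) ℝ := Matrix.of fun q i =>
    if (R q ∧ i ≤ m) ∨ (R i ∧ q ≤ m) then H₁ 0 q i / (l 0 i - l 0 q) else 0 with hKdef
  have hK : K.transpose = -K := by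
    ext q i
    simp only [hKdef, Matrix.transpose_apply, Matrix.of_apply, Matrix.neg_apply]
    rw [show H₁ 0 i q = H₁ 0 q i from congrFun (congrFun hH₁symm q) i,
      ← neg_sub (l 0 i) (l 0 q), div_neg]
    by_cases h : (R q ∧ i ≤ m) ∨ (R i ∧ q ≤ m)
    · rw [if_pos h.symm, if_pos h]
    · rw [if_neg fun h' => h h'.symm, if_neg h, neg_zero]
  set G : ℝ → Matrix (Fin n) (Fin n) ℝ := fun t =>
    NormedSpace.exp (t • -K) * H t * NormedSpace.exp (t • K) with hG
  set C : ℝ → Matrix (Fin n) (Fin n) ℝ := fun t => H₁ t + (H t * K - K * H t) with hC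
  have hG0 : G 0 = H 0 := by simp [hG]
  have hdG : ∀ᶠ t in 𝓝 0, HasDerivAt G
      (NormedSpace.exp (t • -K) * C t * NormedSpace.exp (t • K)) t := by
    filter_upwards [hH] with t ht
    exact hasDerivAt_exp_conj K (Matrix.hasDerivAt_of_entries ht)
  have hdC : HasDerivAt C (H₂ + (H₁ 0 * K - K * H₁ 0)) 0 := by
    have hd := Matrix.hasDerivAt_of_entries hH.self_of_nhds
    exact (Matrix.hasDerivAt_of_entries hH₁).add ((hd.mul_const K).sub (hd.const_mul K))
  have hddG := hasDerivAt_exp_conj K hdC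
  have hlim := tendsto_symm_second_difference
    (F := fun t => ∑ i ∈ Finset.Iic m, G t i i)
    (F' := fun t => ∑ i ∈ Finset.Iic m,
      (NormedSpace.exp (t • -K) * C t * NormedSpace.exp (t • K)) i i)
    (hdG.mono fun t ht => HasDerivAt.fun_sum fun i _ => Matrix.hasDerivAt_entry ht i i)
    (HasDerivAt.fun_sum fun i _ => Matrix.hasDerivAt_entry hddG i i)
  have hle : ∀ᶠ t in 𝓝 0, ∑ i ∈ Finset.Iic m, l t i ≤ ∑ i ∈ Finset.Iic m, G t i i := by
    filter_upwards [hsymm, hmono, hl] with t h₁ h₂ h₃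
    obtain ⟨hT, hE, hE'⟩ := Matrix.exp_smul_orthogonal hK t
    have := h₁.sum_le_sum_diag_conj h₂ h₃ (Q := NormedSpace.exp (t • K)) (hT ▸ hE)
      (hT ▸ hE') m
    rwa [hT] at this
  have hneg : Tendsto (fun t : ℝ => -t) (𝓝 0) (𝓝 0) := by
    simpa using (continuous_neg (G := ℝ)).tendsto 0
  refine (le_of_tendsto_of_tendsto hc hlim ?_).trans_eq ?_
  · filter_upwards [hle.filter_mono nhdsWithin_le_nhds,
      (hneg.eventually hle).filter_mono nhdsWithin_le_nhds] with t h₁ h₂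
    have h₃ : ∑ i ∈ Finset.Iic m, G 0 i i = ∑ i ∈ Finset.Iic m, l 0 i := by
      simp [hG0, hdiag]
    rw [h₃]
    gcongr
  · refine Finset.sum_congr rfl fun i hi => ?_
    have hi' : i ≤ m := Finset.mem_Iic.1 hi
    simp only [zero_smul, NormedSpace.exp_zero, Matrix.one_mul, Matrix.mul_one]
    have hC0 : C 0 = H₁ 0 + (Matrix.diagonal (l 0) * K - K * Matrix.diagonal (l 0)) := by
      rw [← hdiag]
    rw [hC0, Matrix.second_variation_diag_apply _ _ _ _ hH₁symm hK, Finset.mul_sum]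
    congr 1
    refine Finset.sum_congr rfl fun q _ => ?_
    by_cases hq : R q
    · have hne : l 0 i - l 0 q ≠ 0 := (sub_neg.2 (hRi i hi' q hq)).ne
      simp only [hKdef, Matrix.of_apply, hq, hi', true_and, true_or, if_true]
      field_simp
      ring
    · simp [hKdef, hq, hnR i hi']

end

theorem contDiffOn_pd {n : ℕ} {f : EuclideanSpace ℝ (Fin n) → ℝ}
    {V : Set (EuclideanSpace ℝ (Fin n))} (hV : IsOpen V) {k l : WithTop ℕ∞}
    (hf : ContDiffOn ℝ k f V) (hl : l + 1 ≤ k) (i : ℕ) :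
    ContDiffOn ℝ l (fun x => pd f x i) V := by
  unfold pd
  split_ifs with h
  · exact (hf.fderiv_of_isOpen hV hl).clm_apply contDiffOn_const
  · exact contDiffOn_const

theorem Set.EqOn.pd_eq {n : ℕ} {f g : EuclideanSpace ℝ (Fin n) → ℝ}
    {V : Set (EuclideanSpace ℝ (Fin n))} (hV : IsOpen V) (hfg : Set.EqOn f g V)
    {x : EuclideanSpace ℝ (Fin n)} (hx : x ∈ V) (i : ℕ) : pd f x i = pd g x i := by
  unfold pd
  rw [(hfg.eventuallyEq_of_mem (hV.mem_nhds hx)).fderiv_eq]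

/-- Partial derivatives of a `C²` function commute. -/
theorem pd_comm {n : ℕ} {f : EuclideanSpace ℝ (Fin n) → ℝ}
    {V : Set (EuclideanSpace ℝ (Fin n))} (hV : IsOpen V) (hf : ContDiffOn ℝ 2 f V)
    {x : EuclideanSpace ℝ (Fin n)} (hx : x ∈ V) (i j : ℕ) :
    pd (fun y => pd f y j) x i = pd (fun y => pd f y i) x j := by
  have hd : DifferentiableAt ℝ (fderiv ℝ f) x :=
    ((hf.fderiv_of_isOpen hV (m := 1) (by norm_num)).contDiffAt
      (hV.mem_nhds hx)).differentiableAt one_ne_zero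
  have hsymm : IsSymmSndFDerivAt ℝ f x :=
    (hf.contDiffAt (hV.mem_nhds hx)).isSymmSndFDerivAt (by simp)
  unfold pd
  by_cases hi : i < n <;> by_cases hj : j < n <;> simp only [hi, hj, dif_pos, dif_neg,
    not_false_eq_true, fderiv_fun_const, Pi.zero_apply, zero_apply]
  rw [fderiv_clm_apply hd (differentiableAt_const _), fderiv_clm_apply hd (differentiableAt_const _)]
  simpa using hsymm.eq _ _

/-- The derivative along a line, in terms of partial derivatives. -/
theorem hasDerivAt_line {n : ℕ} {f : EuclideanSpace ℝ (Fin n) → ℝ}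
    (x v : EuclideanSpace ℝ (Fin n)) {t : ℝ} (hf : DifferentiableAt ℝ f (x + t • v)) :
    HasDerivAt (fun s : ℝ => f (x + s • v)) (∑ a : Fin n, v a * pd f (x + t • v) a) t := by
  have hline : HasDerivAt (fun s : ℝ => x + s • v) v t := by
    simpa using ((hasDerivAt_id t).smul_const v).const_add x
  refine (hf.hasFDerivAt.comp_hasDerivAt t hline).congr_deriv ?_
  have hv : v = ∑ a : Fin n, v a • EuclideanSpace.single a (1 : ℝ) := by
    simpa using ((EuclideanSpace.basisFun (Fin n) ℝ).sum_repr v).symm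
  have hL : ∀ L : EuclideanSpace ℝ (Fin n) →L[ℝ] ℝ,
      L v = ∑ a : Fin n, v a * L (EuclideanSpace.single a 1) := by
    intro L
    conv_lhs => rw [hv]
    simp [map_sum]
  simpa [pd] using hL _

/-- The second derivative along a line, in terms of partial derivatives. -/
theorem hasDerivAt_line_pd {n : ℕ} {f : EuclideanSpace ℝ (Fin n) → ℝ}
    {V : Set (EuclideanSpace ℝ (Fin n))} (hV : IsOpen V) (hf : ContDiffOn ℝ 2 f V)
    (x v : EuclideanSpace ℝ (Fin n)) {t : ℝ} (hx : x + t • v ∈ V) :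
    HasDerivAt (fun s : ℝ => ∑ a : Fin n, v a * pd f (x + s • v) a)
      (∑ a : Fin n, v a * ∑ b : Fin n, v b * pd (fun y => pd f y a) (x + t • v) b) t := by
  refine HasDerivAt.fun_sum fun a _ => (hasDerivAt_line (f := fun y => pd f y a) x v ?_).const_mul (v a)
  exact ((contDiffOn_pd hV hf (l := 1) (by norm_num) a).contDiffAt (hV.mem_nhds hx)).differentiableAt
    one_ne_zero

theorem pd3_rotate {n : ℕ} {u : EuclideanSpace ℝ (Fin n) → ℝ}
    {V : Set (EuclideanSpace ℝ (Fin n))} (hV : IsOpen V) (hu : ContDiffOn ℝ 3 u V)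
    {x : EuclideanSpace ℝ (Fin n)} (hx : x ∈ V) (i j k : ℕ) :
    pd3 u x i j k = pd3 u x k i j := by
  have h₁ : pd3 u x i j k = pd3 u x i k j := Set.EqOn.pd_eq hV (fun y hy =>
    pd_comm hV (hu.of_le (by norm_num)) hy j k) hx i
  exact h₁.trans (pd_comm hV (contDiffOn_pd hV hu (by norm_num) j) hx i k)

theorem pd4_swap_pairs {n : ℕ} {u : EuclideanSpace ℝ (Fin n) → ℝ}
    {V : Set (EuclideanSpace ℝ (Fin n))} (hV : IsOpen V) (hu : ContDiffOn ℝ 4 u V)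
    {x : EuclideanSpace ℝ (Fin n)} (hx : x ∈ V) (i j k l : ℕ) :
    pd4 u x i j k l = pd4 u x k l i j := by
  have hu3 : ContDiffOn ℝ 3 u V := hu.of_le (by norm_num)
  have h₁ : ∀ p q r s, pd4 u x p q r s = pd4 u x p s q r := fun p q r s =>
    Set.EqOn.pd_eq hV (fun y hy => pd3_rotate hV hu3 hy q r s) hx p
  have h₂ : ∀ p q r s, pd4 u x p q r s = pd4 u x q p r s := fun p q r s =>
    pd_comm hV (contDiffOn_pd hV (contDiffOn_pd hV hu (l := 3) (by norm_num) s) (l := 2)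
      (by norm_num) r) hx p q
  rw [h₁ i j k l, h₂ i l j k, h₁ l i j k, h₂ l k i j]

/-- second variation inequality for eigenvalues, Lemma 3.3 of the paper.
Let `u` be `C⁴` near `x₀` with increasing Hessian eigenvalues `lam x 0 ≤ ⋯ ≤ lam x (n-1)`
(encoded via the characteristic polynomial), with `D²u(x₀)` diagonal with entries
`lam x₀ i`.  Assume each eigenvalue function is twice differentiable at `x₀` in the
Alexandrov sense, with first derivatives `Dl i` and symmetric second derivatives `D2l i`
(expressed by the second-order Taylor expansion hypothesis `hAlex`).  Fix `1 ≤ m ≤ n`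
and let `ρ` (with `m ≤ ρ ≤ n`) be the largest index with `λ_ρ = λ_m` (in the paper's
1-based labelling; below the paper's `λ_i` is `lam x₀ (i-1)` and `q > ρ` becomes
`ρ ≤ q < n`).  Then, as quadratic forms in `(a, b)` (0-based paper indices `α = 1, …, m`
become `α ∈ range m`):
`∑_{α<m} (λ_α)_{ab} ≤ ∑_{α<m} u_{ααab} + 2 ∑_{α<m} ∑_{ρ≤q<n} u_{qαa} u_{qαb}/(λ_α−λ_q)`. -/
theorem eigenvalue_second_variation (n : ℕ)
    (u : EuclideanSpace ℝ (Fin n) → ℝ) (x₀ : EuclideanSpace ℝ (Fin n))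
    (V : Set (EuclideanSpace ℝ (Fin n))) (hV : IsOpen V) (hx₀ : x₀ ∈ V)
    (hu : ContDiffOn ℝ 4 u V)
    (lam : EuclideanSpace ℝ (Fin n) → ℕ → ℝ)
    (hlam : ∀ x ∈ V, (∀ i j : Fin n, i ≤ j → lam x i ≤ lam x j) ∧
      (hessM u x).charpoly = ∏ i : Fin n, (Polynomial.X - Polynomial.C (lam x (i : ℕ))))
    (hdiag : ∀ i j : Fin n, hessM u x₀ i j = if i = j then lam x₀ (i : ℕ) else 0)
    (Dl : ℕ → Fin n → ℝ) (D2l : ℕ → Matrix (Fin n) (Fin n) ℝ)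
    (hAlex : ∀ i < n, (∀ a b : Fin n, D2l i a b = D2l i b a) ∧
      (fun y => lam y i - lam x₀ i - ∑ a, Dl i a * (y - x₀) a
          - (1 / 2) * ∑ a, ∑ b, D2l i a b * (y - x₀) a * (y - x₀) b)
        =o[nhds x₀] (fun y => ‖y - x₀‖ ^ 2))
    (m ρ : ℕ) (hm1 : 1 ≤ m) (hmρ : m ≤ ρ) (hρn : ρ ≤ n)
    (hρeq : lam x₀ (ρ - 1) = lam x₀ (m - 1))
    (hρmax : ∀ q, ρ ≤ q → q < n → lam x₀ (m - 1) < lam x₀ q) :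
    ∀ ξ : Fin n → ℝ,
      0 ≤ ∑ a : Fin n, ∑ b : Fin n,
        ((∑ α ∈ Finset.range m, pd4 u x₀ (α : ℕ) (α : ℕ) (a : ℕ) (b : ℕ)
          + 2 * ∑ α ∈ Finset.range m, ∑ q ∈ Finset.Ico ρ n,
              pd3 u x₀ q α (a : ℕ) * pd3 u x₀ q α (b : ℕ) / (lam x₀ α - lam x₀ q))
          - ∑ α ∈ Finset.range m, D2l α a b) * ξ a * ξ b := by
  intro ξ
  have hn : m - 1 < n := by omega
  set μ : Fin n := ⟨m - 1, hn⟩ with hμ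
  have hrange : ∀ f : ℕ → ℝ, ∑ α ∈ Finset.range m, f α = ∑ i ∈ Finset.Iic μ, f i := by
    intro f
    have : Finset.range m = (Finset.Iic μ).map Fin.valEmbedding := by
      rw [Fin.map_valEmbedding_Iic]
      ext q
      simp only [Finset.mem_range, Finset.mem_Iic, hμ]
      omega
    rw [this, Finset.sum_map]
    rfl
  have hIco : ∀ f : ℕ → ℝ, ∑ q ∈ Finset.Ico ρ n, f q
      = ∑ q : Fin n, if ρ ≤ (q : ℕ) then f q else 0 := by
    intro f
    rw [← Finset.sum_range fun q => if ρ ≤ q then f q else 0, ← Finset.sum_filter]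
    refine Finset.sum_congr ?_ fun _ _ => rfl
    ext q
    simp [and_comm]
  set v : EuclideanSpace ℝ (Fin n) := WithLp.toLp 2 ξ with hv
  have hlineV : ∀ᶠ t : ℝ in nhds 0, x₀ + t • v ∈ V := by
    have hc : ContinuousAt (fun t : ℝ => x₀ + t • v) 0 := by fun_prop
    exact hc.eventually_mem (hV.mem_nhds (by simpa using hx₀))
  have h0 : x₀ + (0 : ℝ) • v = x₀ := by simp
  have hhess : ∀ i j : Fin n, ContDiffOn ℝ 2 (fun x => hessM u x i j) V := fun i j =>
    contDiffOn_pd hV (contDiffOn_pd hV hu (l := 3) (by norm_num) j) (l := 2) (by norm_num) i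
  have hAlex' : ∀ i : Fin n, Tendsto
      (fun t : ℝ => (lam (x₀ + t • v) i + lam (x₀ + -t • v) i
        - 2 * lam (x₀ + (0 : ℝ) • v) i) / t ^ 2)
      (𝓝[>] 0) (𝓝 (∑ a, ∑ b, D2l i a b * ξ a * ξ b)) := by
    intro i
    refine tendsto_symm_second_difference_of_isLittleO (b := ∑ a, Dl i a * ξ a) ?_
    have hto : Tendsto (fun t : ℝ => x₀ + t • v) (𝓝 0) (𝓝 x₀) := by
      have hc : ContinuousAt (fun t : ℝ => x₀ + t • v) 0 := by fun_prop
      simpa [ContinuousAt] using hc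
    have h₁ := (hAlex i i.2).2.comp_tendsto hto
    refine (h₁.congr_left fun t => ?_).trans_isBigO ?_
    · simp only [h0]
      simp only [Function.comp_def, add_sub_cancel_left, PiLp.smul_apply, smul_eq_mul, hv,
        Finset.mul_sum]
      congr 1
      · congr 1
        exact Finset.sum_congr rfl fun a _ => by ring
      · exact Finset.sum_congr rfl fun a _ => Finset.sum_congr rfl fun b _ => by ring
    · refine Asymptotics.IsBigO.of_bound (‖v‖ ^ 2) (Eventually.of_forall fun t => ?_)
      simp only [Function.comp_def, add_sub_cancel_left, norm_smul, norm_pow, norm_mul, norm_norm]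
      rw [mul_pow, mul_comm]
  have key := Matrix.second_variation_sum_eigenvalues_le
    (H := fun t => hessM u (x₀ + t • v))
    (H₁ := fun t => Matrix.of fun i j =>
      ∑ a : Fin n, v a * pd (fun x => hessM u x i j) (x₀ + t • v) a)
    (H₂ := Matrix.of fun i j => ∑ a : Fin n, v a * ∑ b : Fin n, v b *
      pd (fun y => pd (fun x => hessM u x i j) y a) (x₀ + (0 : ℝ) • v) b)
    (l := fun t i => lam (x₀ + t • v) i)
    (c := ∑ i ∈ Finset.Iic μ, ∑ a, ∑ b, D2l i a b * ξ a * ξ b)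
    (hlineV.mono fun t ht => Matrix.IsHermitian.ext fun i j => by
      simpa [hessM] using pd_comm hV (hu.of_le (by norm_num)) ht j i)
    (hlineV.mono fun t ht i j hij => (hlam _ ht).1 i j hij)
    (hlineV.mono fun t ht => (hlam _ ht).2)
    (hlineV.mono fun t ht i j => hasDerivAt_line (f := fun x => hessM u x i j) x₀ v
      (((hhess i j).contDiffAt (hV.mem_nhds ht)).differentiableAt two_ne_zero))
    (fun i j => hasDerivAt_line_pd hV (hhess i j) x₀ v (by simpa using hx₀))
    (by
      ext i j
      simp only [h0, hdiag, Matrix.diagonal_apply])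
    μ (fun q => ρ ≤ (q : ℕ))
    (fun q => by
      simp only [h0]
      refine ⟨fun h => hρmax q h q.2, fun h => ?_⟩
      by_contra hq
      have hρ : ρ - 1 < n := by omega
      have := (hlam x₀ hx₀).1 q ⟨ρ - 1, hρ⟩ (Fin.mk_le_mk.2 (by omega))
      simp only [hρeq] at this
      exact absurd h (not_lt.2 this))
    (by
      refine (tendsto_finsetSum (Finset.Iic μ) fun i _ => hAlex' i).congr fun t => ?_
      rw [← Finset.sum_div, Finset.sum_sub_distrib, Finset.sum_add_distrib, Finset.mul_sum])
  simp only [Matrix.of_apply, h0] at key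
  have hfirst : ∀ q i : Fin n, ∑ a : Fin n, v a * pd (fun x => hessM u x q i) x₀ a
      = ∑ a : Fin n, pd3 u x₀ q i a * ξ a := fun q i =>
    Finset.sum_congr rfl fun a _ => by
      rw [pd3_rotate hV (hu.of_le (by norm_num)) hx₀, mul_comm]
      rfl
  have hsecond : ∀ i : Fin n, ∑ a : Fin n, v a * ∑ b : Fin n, v b *
      pd (fun y => pd (fun x => hessM u x i i) y a) x₀ b
      = ∑ a : Fin n, ∑ b : Fin n, pd4 u x₀ i i a b * ξ a * ξ b := by
    intro i
    rw [Finset.sum_comm]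
    refine Finset.sum_congr rfl fun a _ => ?_
    rw [Finset.mul_sum]
    refine Finset.sum_congr rfl fun b _ => ?_
    rw [pd4_swap_pairs hV hu hx₀]
    change ξ a * (ξ b * pd4 u x₀ b a i i) = _
    ring
  simp only [hfirst, hsecond] at key
  have hsq : ∀ q i : Fin n, (∑ a : Fin n, pd3 u x₀ q i a * ξ a) ^ 2 / (lam x₀ i - lam x₀ q)
      = ∑ a : Fin n, ∑ b : Fin n,
        pd3 u x₀ q i a * pd3 u x₀ q i b / (lam x₀ i - lam x₀ q) * ξ a * ξ b := by
    intro q i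
    rw [sq, Finset.sum_mul_sum, Finset.sum_div]
    refine Finset.sum_congr rfl fun a _ => ?_
    rw [Finset.sum_div]
    exact Finset.sum_congr rfl fun b _ => by ring
  have hquad : ∀ (s : Finset (Fin n)) (f : Fin n → Fin n → Fin n → ℝ),
      ∑ a, ∑ b, (∑ i ∈ s, f i a b) * ξ a * ξ b = ∑ i ∈ s, ∑ a, ∑ b, f i a b * ξ a * ξ b := by
    intro s f
    simp only [Finset.sum_mul]
    rw [Finset.sum_comm (s := s)]
    exact Finset.sum_congr rfl fun a _ => Finset.sum_comm
  have hlin : ∀ P S D : Fin n → Fin n → ℝ,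
      ∑ a, ∑ b, (P a b + 2 * S a b - D a b) * ξ a * ξ b = ∑ a, ∑ b, P a b * ξ a * ξ b
        + 2 * (∑ a, ∑ b, S a b * ξ a * ξ b) - ∑ a, ∑ b, D a b * ξ a * ξ b := by
    intro P S D
    simp only [Finset.mul_sum, ← Finset.sum_add_distrib, ← Finset.sum_sub_distrib]
    exact Finset.sum_congr rfl fun a _ => Finset.sum_congr rfl fun b _ => by ring
  simp only [hrange, hIco]
  rw [hlin (fun a b => ∑ i ∈ Finset.Iic μ, pd4 u x₀ i i a b)
    (fun a b => ∑ i ∈ Finset.Iic μ, ∑ q : Fin n, if ρ ≤ (q : ℕ) then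
      pd3 u x₀ q i a * pd3 u x₀ q i b / (lam x₀ i - lam x₀ q) else 0)
    (fun a b => ∑ i ∈ Finset.Iic μ, D2l i a b), hquad, hquad]
  refine sub_nonneg.2 ((hquad _ fun i a b => D2l i a b).trans_le (key.trans_eq ?_))
  rw [Finset.sum_add_distrib, ← Finset.mul_sum]
  congr 2
  refine Finset.sum_congr rfl fun i _ => ?_
  rw [hquad]
  refine Finset.sum_congr rfl fun q _ => ?_
  split_ifs
  · exact hsq q i
  · simp
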